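/- Nonexistence of an a priori estimate for N₁*: for every T > 0 and every constant C > 0, there exists a C¹ function v : ℝ → ℂ supported in [-T/2, T/2] with ‖v‖_{L²(ℝ)} = 1 and, for some ξ with |ξ| arbitrarily large, ‖v' + t|ξ| v‖_{L²(ℝ)} ≤ C. More precisely: for every ε > 0 and T > 0 there exist ξ ∈ ℝ and v ∈ C_c^∞((-T/2, T/2)) with ‖v‖_{L²} = 1 and ‖v' + t|ξ| v‖_{L²} < ε. -/

import Mathlib

open MeasureTheory

/-- An upper bound for the `L²` norm of a function bounded by `c` and vanishing outside `[-r, r]`. -/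
lemma eLpNorm_two_le_of_bound_Icc {u : ℝ → ℂ} {c r : ℝ} (hc : 0 ≤ c)
    (hu : ∀ t, ‖u t‖ ≤ c) (h0 : ∀ t, t ∉ Set.Icc (-r) r → u t = 0) :
    eLpNorm u 2 volume ≤ ENNReal.ofReal c * ENNReal.ofReal (2 * r) ^ (1 / 2 : ℝ) := by
  have h : eLpNorm u 2 volume ≤
      eLpNorm ((Set.Icc (-r) r).indicator fun _ => c) 2 volume := by
    refine eLpNorm_mono_real fun t => ?_
    by_cases ht : t ∈ Set.Icc (-r) r
    · simpa [ht] using hu t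
    · simp [ht, h0 t ht]
  refine h.trans (le_of_eq ?_)
  rw [eLpNorm_indicator_const measurableSet_Icc (by norm_num) (by norm_num), Real.volume_Icc,
    Real.enorm_of_nonneg hc]
  norm_num [two_mul]

/-- A lower bound for the `L²` norm of a function bounded below on `[-r, r]`. -/
lemma le_eLpNorm_two_of_bound_Icc {u : ℝ → ℂ} {c r : ℝ} (hc : 0 ≤ c)
    (hu : ∀ t ∈ Set.Icc (-r) r, c ≤ ‖u t‖) :
    ENNReal.ofReal c * ENNReal.ofReal (2 * r) ^ (1 / 2 : ℝ) ≤ eLpNorm u 2 volume := by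
  have h : eLpNorm ((Set.Icc (-r) r).indicator fun _ => c) 2 volume ≤ eLpNorm u 2 volume := by
    refine eLpNorm_mono fun t => ?_
    by_cases ht : t ∈ Set.Icc (-r) r
    · simpa [ht, abs_of_nonneg hc] using hu t ht
    · simp [ht]
  refine le_trans (le_of_eq ?_) h
  rw [eLpNorm_indicator_const measurableSet_Icc (by norm_num) (by norm_num), Real.volume_Icc,
    Real.enorm_of_nonneg hc]
  norm_num [two_mul]

/-- Nonexistence of an a priori estimate for `N₁*`: for every `ε > 0` and
`T > 0` there exist `ξ ∈ ℝ` and a smooth compactly supported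
`v : ℝ → ℂ` with support in `(-T/2, T/2)`, `‖v‖_{L²} = 1` and
`‖v' + t|ξ| v‖_{L²} < ε`. -/
theorem stmt_5 (ε T : ℝ) (hε : 0 < ε) (hT : 0 < T) :
    ∃ (ξ : ℝ) (v : ℝ → ℂ),
      ContDiff ℝ (⊤ : ℕ∞) v ∧ HasCompactSupport v ∧
      tsupport v ⊆ Set.Ioo (-T / 2) (T / 2) ∧
      eLpNorm v 2 volume = 1 ∧
      eLpNorm (fun t => deriv v t + (t * |ξ| : ℝ) * v t) 2 volume
        < ENNReal.ofReal ε := by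
  obtain ⟨a, ha, hTa⟩ : ∃ a : ℝ, 0 < a ∧ T = 8 * a := ⟨T / 8, by positivity, by ring⟩
  let f : ContDiffBump (0 : ℝ) := ⟨a, 2 * a, ha, by linarith⟩
  have hfs : ContDiff ℝ (⊤ : ℕ∞) f := f.contDiff
  have hfd : Differentiable ℝ f := hfs.differentiable (by simp)
  have hft : tsupport f = Set.Icc (-(2 * a)) (2 * a) := by
    rw [f.tsupport_eq, Real.closedBall_eq_Icc]; simp [f]
  obtain ⟨M, hM⟩ := f.hasCompactSupport.deriv.exists_bound_of_continuous
    (hfs.continuous_deriv (by simp))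
  have hM0 : 0 ≤ M := (norm_nonneg _).trans (hM 0)
  obtain ⟨ξ, hξ0, hξ⟩ : ∃ ξ : ℝ, 0 ≤ ξ ∧
      2 * M * Real.exp (-(3 * a ^ 2 / 8 * ξ)) < ε := by
    have h1 : Filter.Tendsto (fun ξ : ℝ => 2 * M * Real.exp (-(3 * a ^ 2 / 8 * ξ)))
        Filter.atTop (nhds (2 * M * 0)) :=
      (Real.tendsto_exp_neg_atTop_nhds_zero.comp
        (Filter.tendsto_id.const_mul_atTop (by positivity))).const_mul _
    rw [mul_zero] at h1
    exact ((Filter.eventually_ge_atTop 0).and (h1.eventually_lt_const hε)).exists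
  let g : ℝ → ℝ := fun t => f t * Real.exp (-(t ^ 2 * ξ / 2))
  let G : ℝ → ℂ := fun t => (g t : ℂ)
  have hgs : ContDiff ℝ (⊤ : ℕ∞) g := hfs.mul (by fun_prop)
  have hGs : ContDiff ℝ (⊤ : ℕ∞) G := Complex.ofRealCLM.contDiff.comp hgs
  have hG0 : ∀ t, f t = 0 → G t = 0 := fun t ht => by simp [G, g, ht]
  have hgd : ∀ t, HasDerivAt g (deriv f t * Real.exp (-(t ^ 2 * ξ / 2)) - t * ξ * g t) t := by
    intro t
    have h1 : HasDerivAt (fun t : ℝ => -(t ^ 2 * ξ / 2)) (-(t * ξ)) t := by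
      refine (((hasDerivAt_pow 2 t).mul_const ξ).div_const 2).neg.congr_deriv ?_
      norm_num
      ring
    refine ((hfd t).hasDerivAt.mul h1.exp).congr_deriv ?_
    simp only [g]
    ring
  have hlow : ENNReal.ofReal (Real.exp (-(a ^ 2 * ξ / 8))) *
      ENNReal.ofReal (2 * (a / 2)) ^ (1 / 2 : ℝ) ≤ eLpNorm G 2 volume := by
    refine le_eLpNorm_two_of_bound_Icc (Real.exp_nonneg _) fun t ht => ?_
    have hf1 : f t = 1 := f.one_of_mem_closedBall (by
      rw [Real.closedBall_eq_Icc]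
      exact ⟨by simp only [f]; linarith [ht.1], by simp only [f]; linarith [ht.2]⟩)
    simp only [G, g, hf1, one_mul, Complex.norm_real, Real.norm_eq_abs, Real.abs_exp]
    apply Real.exp_le_exp.2
    have : t ^ 2 ≤ (a / 2) ^ 2 := sq_le_sq' ht.1 ht.2
    nlinarith
  have hup : eLpNorm (fun t => ((deriv f t * Real.exp (-(t ^ 2 * ξ / 2)) : ℝ) : ℂ)) 2 volume ≤
      ENNReal.ofReal (M * Real.exp (-(a ^ 2 * ξ / 2))) *
      ENNReal.ofReal (2 * (2 * a)) ^ (1 / 2 : ℝ) := by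
    refine eLpNorm_two_le_of_bound_Icc (by positivity) (fun t => ?_) fun t ht => ?_
    · rw [Complex.norm_real, norm_mul, Real.norm_eq_abs (Real.exp _), Real.abs_exp]
      by_cases hta : |t| < a
      · have h1 : deriv f t = 0 := by
          have : f =ᶠ[nhds t] fun _ => (1 : ℝ) :=
            f.eventuallyEq_one_of_mem_ball (by simpa [f] using hta)
          rw [this.deriv_eq, deriv_const]
        rw [h1, norm_zero, zero_mul]; positivity
      · refine mul_le_mul (hM t) (Real.exp_le_exp.2 ?_) (Real.exp_nonneg _) hM0
        have : a ^ 2 ≤ t ^ 2 := by rw [← sq_abs t]; gcongr; exact not_lt.1 hta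
        nlinarith
    · have : deriv f t = 0 := by
        rw [← hft] at ht
        exact image_eq_zero_of_notMem_tsupport fun h => ht (tsupport_deriv_subset h)
      simp [this]
  have hGc : HasCompactSupport G := f.hasCompactSupport.mono fun t ht h => ht (hG0 t h)
  have hGfin : eLpNorm G 2 volume ≠ ⊤ :=
    (hGs.continuous.memLp_of_hasCompactSupport hGc).eLpNorm_ne_top
  have hs0 : ENNReal.ofReal (2 * (a / 2)) ^ (1 / 2 : ℝ) ≠ 0 := by
    simp [ha]
  have hst : ENNReal.ofReal (2 * (a / 2)) ^ (1 / 2 : ℝ) ≠ ⊤ :=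
    ENNReal.rpow_ne_top_of_nonneg (by norm_num) ENNReal.ofReal_ne_top
  have hGpos : eLpNorm G 2 volume ≠ 0 := by
    refine (lt_of_lt_of_le (ENNReal.mul_pos ?_ hs0) hlow).ne'
    simp [Real.exp_pos]
  have hs : ENNReal.ofReal (2 * (2 * a)) ^ (1 / 2 : ℝ) =
      ENNReal.ofReal 2 * ENNReal.ofReal (2 * (a / 2)) ^ (1 / 2 : ℝ) := by
    rw [show 2 * (2 * a) = 2 ^ (2 : ℝ) * (2 * (a / 2)) by norm_num; ring,
      ENNReal.ofReal_mul (by positivity), ENNReal.mul_rpow_of_nonneg _ _ (by norm_num),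
      ← ENNReal.ofReal_rpow_of_pos (by norm_num), ← ENNReal.rpow_mul]
    norm_num
  have hlt : eLpNorm (fun t => ((deriv f t * Real.exp (-(t ^ 2 * ξ / 2)) : ℝ) : ℂ)) 2 volume <
      ENNReal.ofReal ε * eLpNorm G 2 volume := by
    refine hup.trans_lt (lt_of_lt_of_le ?_ (mul_le_mul_right hlow _))
    rw [hs, ← mul_assoc, ← mul_assoc, ← ENNReal.ofReal_mul (by positivity),
      ← ENNReal.ofReal_mul hε.le]
    refine ENNReal.mul_lt_mul_left hs0 hst ((ENNReal.ofReal_lt_ofReal_iff (by positivity)).2 ?_)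
    have h1 : Real.exp (-(a ^ 2 * ξ / 2)) =
        Real.exp (-(3 * a ^ 2 / 8 * ξ)) * Real.exp (-(a ^ 2 * ξ / 8)) := by
      rw [← Real.exp_add]; congr 1; ring
    rw [h1]
    nlinarith [Real.exp_pos (-(a ^ 2 * ξ / 8))]
  set N := (eLpNorm G 2 volume).toReal
  have hNpos : 0 < N := ENNReal.toReal_pos hGpos hGfin
  have hNe : ‖N⁻¹‖ₑ = (eLpNorm G 2 volume)⁻¹ := by
    rw [Real.enorm_of_nonneg (by positivity), ENNReal.ofReal_inv_of_pos hNpos,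
      ENNReal.ofReal_toReal hGfin]
  have hsub : tsupport (N⁻¹ • G) ⊆ tsupport f :=
    closure_mono fun t ht h => ht (by simp [hG0 t h])
  refine ⟨ξ, N⁻¹ • G, contDiff_const.smul hGs, ?_, ?_, ?_, ?_⟩
  · exact f.hasCompactSupport.mono fun t ht h => ht (by simp [hG0 t h])
  · refine hsub.trans (hft.trans_subset fun t ht => ⟨?_, ?_⟩) <;> linarith [ht.1, ht.2]
  · rw [eLpNorm_const_smul, hNe, ENNReal.inv_mul_cancel hGpos hGfin]
  · have herr : (fun t => deriv (N⁻¹ • G) t + (t * |ξ| : ℝ) * (N⁻¹ • G) t) =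
        N⁻¹ • fun t => ((deriv f t * Real.exp (-(t ^ 2 * ξ / 2)) : ℝ) : ℂ) := by
      funext t
      rw [((hgd t).ofReal_comp.const_smul N⁻¹).deriv, abs_of_nonneg hξ0]
      simp only [G, Pi.smul_apply, Complex.real_smul]
      push_cast
      ring
    rw [herr, eLpNorm_const_smul, hNe, mul_comm, ← div_eq_mul_inv]
    exact ENNReal.div_lt_of_lt_mul hlt
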